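/- arXiv:1207.6182 — 2 statements merged into one kernel-verified Lean document; each statement's English description precedes it below -/
import Mathlib

section
/- Let N⁴₂₁ = ∂B⁵₂₁ be the boundary complex of B⁵₂₁, where B⁵₂₁ is the pure 5-dimensional simplicial complex on V₂₁ = {a_i, b_i, c_i : i ∈ Z₇} whose 56 facets are the Z₇-images (indices mod 7) of a₀a₁a₂b₀b₁c₀, a₀a₁a₂b₁b₂c₀, a₀a₁a₂a₃b₁b₂, a₀a₁b₀b₁c₀c₃, a₀b₀b₁b₃c₀c₃, a₀b₀b₃c₀c₃c₄, a₃b₀b₃c₀c₃c₄, a₃b₃c₀c₃c₄c₆. Then N⁴₂₁ is a 2-neighborly 4-dimensional weak pseudomanifold on 21 vertices, every vertex link of N⁴₂₁ is a stacked 3-sphere (i.e., N⁴₂₁ ∈ K(4)), its face vector is (f₀, f₁, f₂, f₃, f₄) = (21, 210, 490, 525, 210), and its Euler characteristic is χ = −14, so that f₀(f₀ − 11) = −15χ. -/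
variable {V : Type*} [DecidableEq V]

/-- The number of faces of the complex with facet set `F` having exactly `k` vertices
(i.e. of dimension `k - 1`). -/
def faceCount (F : Finset (Finset V)) (k : ℕ) : ℕ :=
  (F.biUnion fun σ => σ.powersetCard k).card

/-- The vertex set of the complex with facet set `F`. -/
def vertexSet (F : Finset (Finset V)) : Finset V := F.biUnion id

/-- The dual graph of a pure `d`-dimensional complex given by its facet set `F`:
two facets are adjacent iff their intersection has `d` vertices (dimension `d-1`). -/
def dualGraph (d : ℕ) (F : Finset (Finset V)) : SimpleGraph {σ // σ ∈ F} where
  Adj σ τ := σ ≠ τ ∧ (σ.1 ∩ τ.1).card = d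
  symm := ⟨fun σ τ h => ⟨h.1.symm, by rw [Finset.inter_comm]; exact h.2⟩⟩
  loopless := ⟨fun σ h => h.1 rfl⟩

/-- `IsStackedBall d F` : the pure `d`-dimensional complex with facet set `F` is a
stacked `d`-ball, i.e. it is obtained from a single `d`-simplex by repeatedly gluing
a new `d`-simplex `σ` along a single `(d-1)`-face `τ` lying in exactly one facet of the previous complex
(so that the intersection of the old complex with the new simplex is exactly `τ̄`). -/
inductive IsStackedBall : ℕ → Finset (Finset V) → Prop
  | single (d : ℕ) (σ : Finset V) (h : σ.card = d + 1) : IsStackedBall d {σ}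
  | glue (d : ℕ) (F : Finset (Finset V)) (σ τ : Finset V) :
      IsStackedBall d F → σ.card = d + 1 → σ ∉ F → τ ⊆ σ → τ.card = d →
      (∃! ρ, ρ ∈ F ∧ τ ⊆ ρ) → (∀ ρ ∈ F, ρ ∩ σ ⊆ τ) → IsStackedBall d (insert σ F)

/-- The facet set of the link of the vertex `x` in the pure complex with facet set `F`. -/
def linkFacets (F : Finset (Finset V)) (x : V) : Finset (Finset V) :=
  (F.filter fun σ => x ∈ σ).image fun σ => σ.erase x

/-- The facet set of the boundary of a pure `d`-dimensional weak pseudomanifold with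
facet set `F` : the `d`-element subsets of facets lying in exactly one facet. -/
def bdryFacets (d : ℕ) (F : Finset (Finset V)) : Finset (Finset V) :=
  (F.biUnion fun σ => σ.powersetCard d).filter fun τ => (F.filter fun σ => τ ⊆ σ).card = 1

/-- A complex (given by its facet set `S`) is a stacked `d`-sphere if it is the boundary
of a stacked `(d+1)`-ball. -/
def IsStackedSphere (d : ℕ) (S : Finset (Finset V)) : Prop :=
  ∃ B : Finset (Finset V), IsStackedBall (d + 1) B ∧ S = bdryFacets (d + 1) B

/-- The vertices `a_i`, `b_i`, `c_i`, `i ∈ Z₇`, of `V₂₁`. -/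
def a (i : ZMod 7) : Fin 3 × ZMod 7 := (0, i)
def b (i : ZMod 7) : Fin 3 × ZMod 7 := (1, i)
def c (i : ZMod 7) : Fin 3 × ZMod 7 := (2, i)

/-- The `Z₇`-action `j ⬝ a_k = a_{j+k}`, `j ⬝ b_k = b_{j+k}`, `j ⬝ c_k = c_{j+k}`. -/
def shift7 (j : ZMod 7) (σ : Finset (Fin 3 × ZMod 7)) : Finset (Fin 3 × ZMod 7) :=
  σ.image fun p => (p.1, p.2 + j)

/-- The eight basic facets of `B⁵₂₁`. -/
def baseB21 : Finset (Finset (Fin 3 × ZMod 7)) :=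
  { {a 0, a 1, a 2, b 0, b 1, c 0}, {a 0, a 1, a 2, b 1, b 2, c 0},
    {a 0, a 1, a 2, a 3, b 1, b 2}, {a 0, a 1, b 0, b 1, c 0, c 3},
    {a 0, b 0, b 1, b 3, c 0, c 3}, {a 0, b 0, b 3, c 0, c 3, c 4},
    {a 3, b 0, b 3, c 0, c 3, c 4}, {a 3, b 3, c 0, c 3, c 4, c 6} }

/-- The facet set of `B⁵₂₁` : all `Z₇`-images of the eight basic facets. -/
def B21 : Finset (Finset (Fin 3 × ZMod 7)) :=
  (Finset.univ : Finset (ZMod 7)).biUnion fun j => baseB21.image (shift7 j)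

/-- The facet set of the boundary complex. -/
def N21 : Finset (Finset (Fin 3 × ZMod 7)) := bdryFacets 5 B21

section Leaves
variable {W α : Type*}

/-- All `k`-element sublists of a vertex list contained in a facet, with the facets containing them. -/
def leaves (mm : α → W → Bool) : List W → ℕ → List α → List (List W × List α)
  | [], 0, F => [([], F)]
  | [], _ + 1, _ => []
  | _ :: _, 0, F => [([], F)]
  | v :: vs, k + 1, F =>
    (match F.filter (fun m => mm m v) with
      | [] => []
      | g :: G => (leaves mm vs k (g :: G)).map (fun p => (v :: p.1, p.2)))
    ++ leaves mm vs (k + 1) F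

theorem leaves_zero (mm : α → W → Bool) (vs : List W) (F : List α) :
    leaves mm vs 0 F = [([], F)] := by cases vs <;> simp [leaves]

theorem mem_leaves (mm : α → W → Bool) (vs : List W) : ∀ (k : ℕ) (F : List α), F ≠ [] →
    ∀ (l : List W) (G : List α), ((l, G) ∈ leaves mm vs k F ↔
      l.Sublist vs ∧ l.length = k ∧ G = F.filter (fun m => l.all (mm m)) ∧ G ≠ []) := by
  induction vs with
  | nil =>
    intro k F hF l G
    cases k with
    | zero =>
      simp only [leaves_zero, List.mem_singleton, Prod.mk.injEq, List.sublist_nil]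
      constructor
      · rintro ⟨rfl, rfl⟩; simp [hF]
      · rintro ⟨rfl, _, rfl, _⟩; simp
    | succ k =>
      simp only [leaves, List.not_mem_nil, List.sublist_nil, false_iff]
      rintro ⟨rfl, h, _⟩
      simp at h
  | cons v vs ih =>
    intro k F hF l G
    cases k with
    | zero =>
      simp only [leaves_zero, List.mem_singleton, Prod.mk.injEq]
      constructor
      · rintro ⟨rfl, rfl⟩; simp [hF]
      · rintro ⟨_, h, rfl, _⟩
        rw [List.length_eq_zero_iff] at h
        subst h; simp
    | succ k =>
      have key : (l, G) ∈ (match F.filter (fun m => mm m v) with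
          | [] => []
          | g :: G => (leaves mm vs k (g :: G)).map
              (fun p : List W × List α => (v :: p.1, p.2))) ↔
          ∃ r, l = v :: r ∧ r.Sublist vs ∧ r.length = k ∧
            G = F.filter (fun m => l.all (mm m)) ∧ G ≠ [] := by
        have hf : ∀ r : List W, F.filter (fun m => (v :: r).all (mm m)) =
            (F.filter (fun m => mm m v)).filter (fun m => r.all (mm m)) := by
          intro r
          rw [List.filter_filter]
          apply List.filter_congr
          intro m _
          rw [List.all_cons, Bool.and_comm]
        rcases hE : F.filter (fun m => mm m v) with _ | ⟨g, G'⟩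
        · simp only [List.not_mem_nil, false_iff]
          rintro ⟨r, rfl, _, _, h, h'⟩
          rw [hf, hE] at h
          exact h' h
        · simp only [List.mem_map, Prod.exists, Prod.mk.injEq]
          constructor
          · rintro ⟨r, H, h, rfl, rfl⟩
            rw [ih k (g :: G') (by simp)] at h
            refine ⟨r, rfl, h.1, h.2.1, ?_, h.2.2.2⟩
            rw [hf, hE]; exact h.2.2.1
          · rintro ⟨r, rfl, h1, h2, h3, h4⟩
            refine ⟨r, G, ?_, rfl, rfl⟩
            rw [ih k (g :: G') (by simp)]
            refine ⟨h1, h2, ?_, h4⟩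
            rw [hf, hE] at h3; exact h3
      rw [leaves, List.mem_append, key, ih (k + 1) F hF, List.sublist_cons_iff]
      constructor
      · rintro (⟨r, rfl, h1, h2, h3, h4⟩ | ⟨h1, h2, h3, h4⟩)
        · exact ⟨Or.inr ⟨r, rfl, h1⟩, by simp [h2], h3, h4⟩
        · exact ⟨Or.inl h1, h2, h3, h4⟩
      · rintro ⟨h1 | ⟨r, rfl, h1⟩, h2, h3, h4⟩
        · exact Or.inr ⟨h1, h2, h3, h4⟩
        · exact Or.inl ⟨r, rfl, h1, by simpa using h2, h3, h4⟩

theorem leaves_nodup (mm : α → W → Bool) (vs : List W) (hvs : vs.Nodup) :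
    ∀ (k : ℕ) (F : List α), F ≠ [] → ((leaves mm vs k F).map Prod.fst).Nodup := by
  induction vs with
  | nil => intro k F hF; cases k <;> simp [leaves]
  | cons v vs ih =>
    intro k F hF
    rw [List.nodup_cons] at hvs
    cases k with
    | zero => simp [leaves_zero]
    | succ k =>
      rw [leaves, List.map_append, List.nodup_append]
      refine ⟨?_, ih hvs.2 _ _ hF, ?_⟩
      · rcases F.filter (fun m => mm m v) with _ | ⟨g, G'⟩
        · simp
        · have := ih hvs.2 k (g :: G') (by simp)
          simp only [List.map_map]
          have e : (Prod.fst ∘ fun p : List W × List α => (v :: p.1, p.2)) =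
            (fun l => v :: l) ∘ Prod.fst := rfl
          rw [e, ← List.map_map]
          exact this.map (fun a b h => by simpa using h)
      · intro l h1 l' h2 hll
        subst hll
        have hv : v ∈ l := by
          rcases hE : F.filter (fun m => mm m v) with _ | ⟨g, G'⟩
          · rw [hE] at h1; simp at h1
          · rw [hE] at h1
            simp only [List.map_map, List.mem_map] at h1
            obtain ⟨p, _, rfl⟩ := h1
            simp
        rw [List.mem_map] at h2
        obtain ⟨⟨p, G⟩, h2, rfl⟩ := h2
        rw [mem_leaves mm vs _ _ hF] at h2
        exact hvs.1 (h2.1.subset hv)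

end Leaves

abbrev VV := Fin 3 × ZMod 7

def idx (v : VV) : ℕ := Nat.add (Nat.mul 7 v.1.1) (@Fin.val 7 v.2)

def vs21 : List VV :=
  [(0,0),(0,1),(0,2),(0,3),(0,4),(0,5),(0,6),(1,0),(1,1),(1,2),(1,3),(1,4),(1,5),(1,6),
   (2,0),(2,1),(2,2),(2,3),(2,4),(2,5),(2,6)]

def mm (m : ℕ) (v : VV) : Bool := Nat.beq (Nat.land (Nat.shiftRight m (idx v)) 1) 1

theorem mm_eq (m : ℕ) (v : VV) : mm m v = Nat.testBit m (idx v) := by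
  have h : Nat.land (Nat.shiftRight m (idx v)) 1 = (m >>> idx v) % 2 :=
    Nat.and_one_is_mod (m >>> idx v)
  rw [Bool.eq_iff_iff, mm, h, Nat.testBit_eq_decide_div_mod_eq, Nat.shiftRight_eq_div_pow]
  simp

theorem vs21_nodup : vs21.Nodup := by decide +kernel
theorem vs21_all : ∀ v : VV, v ∈ vs21 := by decide +kernel

/-- The vertex set with bit mask `m`. -/
def dec (m : ℕ) : Finset VV := (vs21.filter (mm m)).toFinset

theorem mem_dec {m : ℕ} {v : VV} : v ∈ dec m ↔ mm m v = true := by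
  simp [dec, vs21_all]

theorem card_dec (m : ℕ) : (dec m).card = (vs21.filter (mm m)).length :=
  List.toFinset_card_of_nodup (vs21_nodup.filter _)

/-- The complex given by a list of masks. -/
def cx (L : List ℕ) : Finset (Finset VV) := (L.map dec).toFinset

theorem mem_cx {L : List ℕ} {σ : Finset VV} : σ ∈ cx L ↔ ∃ m ∈ L, dec m = σ := by
  simp [cx]

/-- The sorted list of the elements of `s`. -/
def lst (s : Finset VV) : List VV := vs21.filter (fun v => decide (v ∈ s))

theorem lst_toFinset (s : Finset VV) : (lst s).toFinset = s := by
  ext v; simp [lst, vs21_all]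

theorem lst_length (s : Finset VV) : (lst s).length = s.card := by
  have h : (lst s).Nodup := vs21_nodup.filter _
  rw [← List.toFinset_card_of_nodup h, lst_toFinset]

theorem lst_sub (s : Finset VV) : (lst s).Sublist vs21 := List.filter_sublist

theorem lst_eq {l : List VV} (h : l.Sublist vs21) : lst l.toFinset = l := by
  have h1 : l.Nodup := h.nodup vs21_nodup
  unfold lst
  simp only [List.mem_toFinset]
  symm
  apply List.Sublist.eq_of_length_le
  · have : l.filter (fun v => decide (v ∈ l)) = l := by simp
    have h2 := h.filter (fun v => decide (v ∈ l))
    rwa [this] at h2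
  · have h3 := lst_length l.toFinset
    rw [List.toFinset_card_of_nodup h1] at h3
    unfold lst at h3
    simp only [List.mem_toFinset] at h3
    exact h3.le

theorem all_iff {s : Finset VV} {m : ℕ} : (lst s).all (mm m) = true ↔ s ⊆ dec m := by
  rw [List.all_eq_true]
  constructor
  · intro h v hv
    exact mem_dec.2 (h v (by simp [lst, vs21_all, hv]))
  · intro h v hv
    have : v ∈ s := by simpa [lst, vs21_all] using hv
    exact mem_dec.1 (h this)

theorem filter_cx (L : List ℕ) (s : Finset VV) :
    (cx L).filter (fun σ => s ⊆ σ) = cx (L.filter (fun m => (lst s).all (mm m))) := by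
  ext σ
  simp only [Finset.mem_filter, mem_cx, List.mem_filter, all_iff]
  constructor
  · rintro ⟨⟨m, hm, rfl⟩, h⟩; exact ⟨m, ⟨hm, h⟩, rfl⟩
  · rintro ⟨m, ⟨hm, h⟩, rfl⟩; exact ⟨⟨m, hm, rfl⟩, h⟩

theorem card_cx_le (L : List ℕ) : (cx L).card ≤ L.length := by
  simpa [cx] using List.toFinset_card_le (L.map dec)

theorem mem_faces {L : List ℕ} {k : ℕ} {s : Finset VV} :
    s ∈ ((cx L).biUnion fun σ => σ.powersetCard k) ↔ (∃ m ∈ L, s ⊆ dec m) ∧ s.card = k := by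
  simp only [Finset.mem_biUnion, mem_cx, Finset.mem_powersetCard]
  constructor
  · rintro ⟨_, ⟨m, hm, rfl⟩, h, hk⟩; exact ⟨⟨m, hm, h⟩, hk⟩
  · rintro ⟨⟨m, hm, h⟩, hk⟩; exact ⟨_, ⟨m, hm, rfl⟩, h, hk⟩

theorem leaf_of {L : List ℕ} {k : ℕ} {s : Finset VV} (h : ∃ m ∈ L, s ⊆ dec m) (hk : s.card = k) :
    (lst s, L.filter (fun m => (lst s).all (mm m))) ∈ leaves mm vs21 k L := by
  obtain ⟨m, hm, h⟩ := h
  rw [mem_leaves _ _ _ _ (List.ne_nil_of_mem hm)]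
  refine ⟨lst_sub s, by rw [lst_length, hk], rfl, List.ne_nil_of_mem (a := m) ?_⟩
  rw [List.mem_filter]
  exact ⟨hm, all_iff.2 h⟩

theorem of_leaf {L : List ℕ} (hL : L ≠ []) {k : ℕ} {l : List VV} {G : List ℕ}
    (h : (l, G) ∈ leaves mm vs21 k L) :
    lst l.toFinset = l ∧ l.toFinset.card = k ∧ G = L.filter (fun m => l.all (mm m)) ∧
      ∃ m ∈ L, l.toFinset ⊆ dec m := by
  rw [mem_leaves _ _ _ _ hL] at h
  obtain ⟨h1, h2, h3, h4⟩ := h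
  refine ⟨lst_eq h1, ?_, h3, ?_⟩
  · rw [List.toFinset_card_of_nodup (h1.nodup vs21_nodup), h2]
  · obtain ⟨m, hm⟩ := List.exists_mem_of_ne_nil _ h4
    rw [h3, List.mem_filter] at hm
    refine ⟨m, hm.1, ?_⟩
    rw [← all_iff, lst_eq h1]
    exact hm.2

theorem faceCount_cx (L : List ℕ) (hL : L ≠ []) (k : ℕ) :
    faceCount (cx L) k = (leaves mm vs21 k L).length := by
  have hnd := leaves_nodup mm vs21 vs21_nodup k L hL
  have : ((cx L).biUnion fun σ => σ.powersetCard k) =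
      ((leaves mm vs21 k L).map Prod.fst).toFinset.image List.toFinset := by
    ext s
    rw [mem_faces]
    simp only [Finset.mem_image, List.mem_toFinset, List.mem_map]
    constructor
    · rintro ⟨h, hk⟩
      exact ⟨lst s, ⟨_, leaf_of h hk, rfl⟩, lst_toFinset s⟩
    · rintro ⟨_, ⟨⟨l, G⟩, h, rfl⟩, rfl⟩
      have := of_leaf hL h
      exact ⟨this.2.2.2, this.2.1⟩
  rw [faceCount, this, Finset.card_image_of_injOn, List.toFinset_card_of_nodup hnd, List.length_map]
  intro l hl l' hl' he
  simp only [Finset.mem_coe, List.mem_toFinset, List.mem_map] at hl hl'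
  obtain ⟨⟨l, G⟩, h, rfl⟩ := hl
  obtain ⟨⟨l', G'⟩, h', rfl⟩ := hl'
  have h1 := (of_leaf hL h).1
  have h2 := (of_leaf hL h').1
  simp only at he ⊢
  rw [← h1, ← h2, he]

theorem dec_inj {m n : ℕ} (hm : m < 2 ^ 21) (hn : n < 2 ^ 21) (h : dec m = dec n) : m = n := by
  have h0 : ∀ i < 21, ∃ v : VV, idx v = i := by decide +kernel
  apply Nat.eq_of_testBit_eq
  intro i
  by_cases hi : i < 21
  · obtain ⟨v, rfl⟩ := h0 i hi
    have : v ∈ dec m ↔ v ∈ dec n := by rw [h]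
    rw [mem_dec, mem_dec, mm_eq, mm_eq] at this
    exact Bool.eq_iff_iff.2 this
  · have h2 : 2 ^ 21 ≤ 2 ^ i := Nat.pow_le_pow_right (by norm_num) (by omega)
    rw [Nat.testBit_lt_two_pow (hm.trans_le h2), Nat.testBit_lt_two_pow (hn.trans_le h2)]

theorem card_cx {L : List ℕ} (h : ∀ m ∈ L, m < 2 ^ 21) (hnd : L.Nodup) :
    (cx L).card = L.length := by
  rw [cx, List.toFinset_card_of_nodup, List.length_map]
  exact List.Nodup.map_on (fun x hx y hy => dec_inj (h x hx) (h y hy)) hnd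

def msk (l : List VV) : ℕ := (l.map fun v => 2 ^ idx v).sum

/-- Masks of the boundary facets. -/
def bdL (k : ℕ) (L : List ℕ) : List ℕ :=
  ((leaves mm vs21 k L).filter (fun p => p.2.length == 1)).map (fun p => msk p.1)

theorem bdry_cx {L : List ℕ} (hL : L ≠ []) (h : ∀ m ∈ L, m < 2 ^ 21) (hnd : L.Nodup) (k : ℕ)
    (hmsk : ∀ p ∈ leaves mm vs21 k L, p.2.length = 1 → vs21.filter (mm (msk p.1)) = p.1) :
    bdryFacets k (cx L) = cx (bdL k L) := by
  ext s
  have hc : ((cx L).filter (fun σ => s ⊆ σ)).card =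
      (L.filter (fun m => (lst s).all (mm m))).length := by
    rw [filter_cx, card_cx]
    · intro m hm; exact h m (List.mem_filter.1 hm).1
    · exact hnd.filter _
  rw [bdryFacets, Finset.mem_filter, mem_faces, mem_cx, hc]
  simp only [bdL, List.mem_map, List.mem_filter, beq_iff_eq]
  constructor
  · rintro ⟨⟨h1, h2⟩, h3⟩
    have h4 := leaf_of h1 h2
    refine ⟨_, ⟨_, ⟨h4, h3⟩, rfl⟩, ?_⟩
    rw [dec, hmsk _ h4 h3, lst_toFinset]
  · rintro ⟨_, ⟨⟨l, G⟩, ⟨h4, h3⟩, rfl⟩, rfl⟩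
    have e := hmsk _ h4 h3
    obtain ⟨h5, h6, h7, h8⟩ := of_leaf hL h4
    simp only at e h3
    rw [dec, e, h5, ← h7]
    exact ⟨⟨h8, h6⟩, h3⟩

theorem link_bdry {V : Type*} [DecidableEq V] (d : ℕ) (F : Finset (Finset V)) (x : V) :
    linkFacets (bdryFacets (d + 1) F) x = bdryFacets d (linkFacets F x) := by
  have hcard : ∀ τ : Finset V, x ∉ τ →
      ((linkFacets F x).filter fun σ => τ ⊆ σ).card =
        (F.filter fun σ => insert x τ ⊆ σ).card := by
    intro τ hx
    have : ((linkFacets F x).filter fun σ => τ ⊆ σ) =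
        (F.filter fun σ => insert x τ ⊆ σ).image (fun σ => σ.erase x) := by
      ext ρ
      simp only [linkFacets, Finset.mem_filter, Finset.mem_image, Finset.insert_subset_iff]
      constructor
      · rintro ⟨⟨σ, ⟨h1, h2⟩, rfl⟩, h3⟩
        exact ⟨σ, ⟨h1, h2, h3.trans (Finset.erase_subset _ _)⟩, rfl⟩
      · rintro ⟨σ, ⟨h1, h2, h3⟩, rfl⟩
        exact ⟨⟨σ, ⟨h1, h2⟩, rfl⟩, Finset.subset_erase.2 ⟨h3, hx⟩⟩
    rw [this, Finset.card_image_of_injOn]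
    intro σ h1 σ' h2 h
    simp only [Finset.coe_filter, Set.mem_ofPred_eq, Finset.insert_subset_iff] at h1 h2
    simp only at h
    rw [← Finset.insert_erase h1.2.1, h, Finset.insert_erase h2.2.1]
  ext τ
  constructor
  · intro h
    simp only [linkFacets, bdryFacets, Finset.mem_image, Finset.mem_filter, Finset.mem_biUnion,
      Finset.mem_powersetCard] at h
    obtain ⟨ρ, ⟨⟨⟨σ, h1, h2, h3⟩, h4⟩, h5⟩, rfl⟩ := h
    rw [bdryFacets, Finset.mem_filter, hcard _ (Finset.notMem_erase _ _), Finset.insert_erase h5]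
    refine ⟨?_, h4⟩
    simp only [linkFacets, Finset.mem_image, Finset.mem_filter, Finset.mem_biUnion,
      Finset.mem_powersetCard]
    refine ⟨_, ⟨σ, ⟨h1, h2 h5⟩, rfl⟩, Finset.erase_subset_erase _ h2, ?_⟩
    rw [Finset.card_erase_of_mem h5, h3]; rfl
  · intro h
    rw [bdryFacets, Finset.mem_filter] at h
    obtain ⟨h, h4⟩ := h
    simp only [linkFacets, Finset.mem_image, Finset.mem_filter, Finset.mem_biUnion,
      Finset.mem_powersetCard] at h
    obtain ⟨_, ⟨σ, ⟨h1, h2⟩, rfl⟩, h3, h5⟩ := h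
    have hx : x ∉ τ := fun hh => Finset.notMem_erase x σ (h3 hh)
    rw [hcard _ hx] at h4
    simp only [linkFacets, bdryFacets, Finset.mem_image, Finset.mem_filter, Finset.mem_biUnion,
      Finset.mem_powersetCard]
    refine ⟨insert x τ, ⟨⟨⟨σ, h1, ?_, ?_⟩, h4⟩, Finset.mem_insert_self _ _⟩,
      Finset.erase_insert hx⟩
    · exact Finset.insert_subset h2 (h3.trans (Finset.erase_subset _ _))
    · rw [Finset.card_insert_of_notMem hx, h5]

def subM (m n : ℕ) : Bool := vs21.all fun v => !mm m v || mm n v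

theorem subM_iff {m n : ℕ} : subM m n = true ↔ dec m ⊆ dec n := by
  simp only [subM, List.all_eq_true, Finset.subset_iff, mem_dec, vs21_all, true_imp_iff]
  refine forall_congr' fun v => ?_
  cases mm m v <;> cases mm n v <;> simp

def pc (m : ℕ) : ℕ := (vs21.filter (mm m)).length

/-- Checker for stacking orders. -/
def chk (d : ℕ) : List ℕ → Bool
  | [] => false
  | m :: F => pc m == d + 1 &&
    (F.isEmpty || (chk d F &&
      (let t := F.foldl (fun t r => t ||| (r &&& m)) 0
       pc t == d && subM t m && ((F.filter (subM t)).length == 1) &&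
        F.all (fun r => vs21.all fun v => !(mm r v && mm m v) || mm t v))))

theorem chk_sound (d : ℕ) (L : List ℕ) (h : chk d L = true) : IsStackedBall d (cx L) := by
  induction L with
  | nil => simp [chk] at h
  | cons m F ih =>
    rw [chk] at h
    simp only [Bool.and_eq_true, beq_iff_eq, Bool.or_eq_true] at h
    obtain ⟨h1, h2⟩ := h
    rw [pc, ← card_dec] at h1
    rcases h2 with h2 | ⟨h2, h3⟩
    · rw [List.isEmpty_iff] at h2
      subst h2
      have : cx [m] = {dec m} := by simp [cx]
      rw [this]
      exact IsStackedBall.single d _ h1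
    · generalize F.foldl (fun t r => t ||| (r &&& m)) 0 = t at h3
      obtain ⟨⟨⟨h4, h5⟩, h6⟩, h7⟩ := h3
      rw [pc, ← card_dec] at h4
      rw [subM_iff] at h5
      have e : cx (m :: F) = insert (dec m) (cx F) := by simp [cx]
      have h8 : ∀ ρ ∈ cx F, ρ ∩ dec m ⊆ dec t := by
        intro ρ hρ
        obtain ⟨r, hr, rfl⟩ := mem_cx.1 hρ
        intro v hv
        rw [Finset.mem_inter, mem_dec, mem_dec] at hv
        have := List.all_eq_true.1 (List.all_eq_true.1 h7 r hr) v (vs21_all v)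
        rw [hv.1, hv.2] at this
        rw [mem_dec]
        simpa using this
      rw [e]
      refine IsStackedBall.glue d _ _ (dec t) (ih h2) h1 ?_ h5 h4 ?_ h8
      · intro hm
        have := Finset.card_le_card (h8 _ hm)
        rw [Finset.inter_self] at this
        omega
      · rw [List.length_eq_one_iff] at h6
        obtain ⟨r, hr⟩ := h6
        have hr' : ∀ q, (q ∈ F ∧ dec t ⊆ dec q) ↔ q = r := by
          intro q
          rw [← subM_iff, ← List.mem_filter, hr, List.mem_singleton]
        have hr0 := (hr' r).2 rfl
        refine ⟨dec r, ⟨mem_cx.2 ⟨r, hr0.1, rfl⟩, hr0.2⟩, ?_⟩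
        rintro _ ⟨hρ, hs⟩
        obtain ⟨q, hq, rfl⟩ := mem_cx.1 hρ
        rw [(hr' q).1 ⟨hq, hs⟩]

/-- Bit masks of the facets of `B21`. -/
def LB : List ℕ :=
  [16775, 17159, 783, 147843, 148865, 410753, 410760, 1459208,
   33550, 34318, 1566, 295686, 297730, 821506, 821520, 837648,
   67100, 68636, 3132, 591372, 595460, 1643012, 1643040, 1675296,
   134200, 137272, 6264, 1182744, 1190920, 1205256, 1205312, 1269824,
   268400, 274544, 12401, 284720, 284816, 313488, 313473, 442497,
   536673, 532705, 8419, 569440, 569632, 626976, 626946, 884994,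
   1056963, 1049027, 455, 1122497, 1123008, 1253952, 1253892, 1769988]

/-- Stacking orders (last simplex first) of the vertex links of `B21`. -/
def ordT : List (List ℕ) :=
  [[1122496, 12400, 536672, 532704, 8418, 1056962, 1049026, 454,
   313472, 442496, 410752, 148864, 147842, 782, 17158, 16774],
   [8417, 1056961, 1049025, 453, 626944, 884992, 821504, 297728,
   295684, 1564, 34316, 33548, 147841, 781, 17157, 16773],
   [1253888, 1769984, 451, 1643008, 595456, 591368, 3128, 68632,
   67096, 295682, 1562, 34314, 33546, 779, 17155, 16771],
   [410752, 1459200, 1205248, 1190912, 1182736, 6256, 137264, 134192,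
   591364, 3124, 68628, 67092, 1558, 34310, 33542, 775],
   [821504, 837632, 313472, 284800, 284704, 12385, 274528, 268384,
   1182728, 6248, 137256, 134184, 3116, 68620, 67084, 1550],
   [1643008, 1675264, 626944, 569600, 569408, 8387, 532673, 536641,
   284688, 12369, 274512, 268368, 6232, 137240, 134168, 3100],
   [1205248, 1269760, 1253888, 1122944, 1122433, 391, 1048963, 1056899,
   569376, 8355, 532641, 536609, 12337, 274480, 268336, 6200],
   [1122880, 1122369, 532577, 8291, 1056835, 1048899, 327, 284688,
   313360, 313345, 442369, 410632, 410625, 148737, 147715, 16647],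
   [1048771, 199, 569376, 626720, 626690, 884738, 821264, 821250,
   297474, 295430, 33294, 148609, 147587, 527, 16903, 16519],
   [1122496, 1253440, 1253380, 1769476, 1642528, 1642500, 594948, 590860,
   66588, 297218, 295174, 1054, 33806, 33038, 271, 16647],
   [1204288, 594436, 590348, 33294, 542, 66076, 67612, 2108,
   133176, 1181720, 1189896, 1204232, 1458184, 409736, 409729, 147841],
   [311425, 1188872, 1180696, 66588, 1084, 132152, 135224, 4216,
   266352, 282672, 282768, 311440, 835600, 819472, 819458, 295682],
   [622850, 280720, 280624, 133176, 2168, 264304, 270448, 8305,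
   532577, 565344, 565536, 622880, 1671200, 1638944, 1638916, 591364],
   [1245700, 561440, 561248, 266352, 4209, 528481, 524513, 227,
   1048771, 1114305, 1114816, 1245760, 1261632, 1197120, 1197064, 1182728],
   [268336, 268432, 821264, 297104, 297089, 426113, 1253440, 1188928,
   1188872, 1442824, 394376, 394369, 132481, 131459, 775, 391],
   [536672, 536864, 1642528, 594208, 594178, 852226, 409729, 280705,
   280720, 804880, 788752, 788738, 264962, 262918, 1550, 782],
   [1056961, 1057472, 1204288, 1188416, 1188356, 1704452, 819458, 561410,
   561440, 1609760, 1577504, 1577476, 529924, 525836, 3100, 1564],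
   [1638916, 1122820, 1122880, 311425, 1138752, 1074240, 6200, 3128,
   1051672, 1059848, 1074184, 1328136, 279688, 279681, 17793, 16771],
   [622850, 12400, 6256, 22576, 22672, 33542, 35586, 559362,
   559376, 575504, 51344, 51329, 180353, 1197064, 148616, 148609],
   [1245700, 8417, 12385, 45152, 45344, 67084, 71172, 1118724,
   1118752, 1151008, 102688, 102658, 360706, 313360, 297232, 297218],
   [626720, 594464, 594436, 721412, 205316, 451, 8387, 73921,
   74432, 205376, 221248, 156736, 134168, 142344, 156680, 410632]]

def ord (x : VV) : List ℕ := ordT.getD (idx x) []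

theorem ord_chk : ∀ x ∈ vs21, chk 4 (ord x) = true := by decide +kernel

theorem ord_perm : ∀ x ∈ vs21,
    ((LB.filter (fun m => mm m x)).map (fun m => m - 2 ^ idx x)).isPerm (ord x) = true := by
  decide +kernel

theorem erase_chk : ∀ x ∈ vs21, ∀ m ∈ LB, mm m x = true →
    ∀ v ∈ vs21, mm (m - 2 ^ idx x) v = (mm m v && !decide (v = x)) := by
  decide +kernel

theorem LB_ne : LB ≠ [] := by decide +kernel
theorem LB_lt : ∀ m ∈ LB, m < 2 ^ 21 := by decide +kernel
theorem LB_nodup : LB.Nodup := by decide +kernel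

def LB0 : List ℕ := [16775, 17159, 783, 147843, 148865, 410753, 410760, 1459208]

theorem base_eq : baseB21 = cx LB0 := by
  have : cx LB0 = {dec 16775, dec 17159, dec 783, dec 147843, dec 148865, dec 410753,
      dec 410760, dec 1459208} := by simp [cx, LB0]
  rw [this, baseB21]
  congr 1

theorem shift_fwd : ∀ j : ZMod 7, ∀ i : Fin 8,
    shift7 j (dec (LB0.getD i 0)) = dec (LB.getD (8 * ZMod.val j + i) 0) := by
  decide +kernel

theorem LB_eq : LB = (List.finRange 7).flatMap fun j => (List.finRange 8).map fun i =>
    LB.getD (8 * j.val + i.val) 0 := by decide +kernel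

theorem LB0_eq : LB0 = (List.finRange 8).map fun i => LB0.getD i.val 0 := by decide +kernel

theorem B21_eq : B21 = cx LB := by
  ext σ
  rw [B21, mem_cx, LB_eq, base_eq, cx, LB0_eq]
  simp only [Finset.mem_biUnion, Finset.mem_univ, true_and, Finset.mem_image, List.mem_toFinset,
    List.mem_map, List.mem_flatMap, List.mem_finRange]
  constructor
  · rintro ⟨j, _, ⟨_, ⟨i, rfl⟩, rfl⟩, rfl⟩
    exact ⟨_, ⟨j, i, rfl⟩, (shift_fwd j i).symm⟩
  · rintro ⟨_, ⟨j, i, rfl⟩, rfl⟩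
    exact ⟨j, _, ⟨_, ⟨i, rfl⟩, rfl⟩, shift_fwd j i⟩

/-- Masks of the facets of `N21`. -/
def LN : List ℕ :=
  [271, 527, 199, 327, 16519, 16903, 779, 227, 8291, 8355,
   1048899, 1056835, 131459, 1048963, 1056899, 147587, 17155, 147715, 781, 453,
   16773, 17157, 4209, 8305, 12337, 12369, 524513, 528481, 532641, 536609,
   1049025, 73921, 532673, 1114305, 536641, 1122369, 17793, 132481, 279681, 394369,
   51329, 280705, 297089, 1122433, 180353, 426113, 148737, 410625, 313345, 442369,
   542, 1054, 33038, 33806, 1558, 454, 16774, 17158, 262918, 295174,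
   34310, 295430, 1562, 33546, 34314, 8418, 1049026, 1056962, 147842, 35586,
   264962, 559362, 788738, 102658, 561410, 594178, 360706, 852226, 297474, 821250,
   626690, 884738, 1084, 2108, 66076, 67612, 3116, 33548, 34316, 525836,
   590348, 68620, 590860, 3124, 67092, 68628, 295684, 71172, 529924, 1118724,
   1577476, 205316, 1122820, 1188356, 721412, 1704452, 594948, 1642500, 1253380, 1769476,
   2168, 4216, 132152, 135224, 6232, 67096, 68632, 1051672, 1180696, 137240,
   1181720, 6248, 134184, 137256, 148616, 279688, 394376, 409736, 591368, 142344,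
   1059848, 156680, 1074184, 1328136, 1442824, 1189896, 1204232, 1458184, 264304, 270448,
   134192, 22576, 137264, 280624, 274480, 282672, 268368, 274512, 22672, 268432,
   51344, 297104, 282768, 311440, 297232, 559376, 788752, 819472, 1182736, 575504,
   804880, 835600, 532704, 268384, 45152, 274528, 561248, 565344, 45344, 536864,
   102688, 594208, 565536, 622880, 594464, 1118752, 1577504, 1638944, 284704, 1151008,
   1609760, 1671200, 74432, 1057472, 1114816, 205376, 1188416, 1245760, 156736, 1074240,
   1188928, 1197120, 569408, 221248, 1138752, 1261632, 148864, 1122944, 284800, 442496,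
   297728, 569600, 884992, 595456, 1769984, 1190912, 1459200, 837632, 1675264, 1269760]

theorem LN_eq : LN = bdL 5 LB := by decide +kernel

theorem N21_eq : N21 = cx LN := by
  rw [N21, B21_eq, LN_eq]
  exact bdry_cx LB_ne LB_lt LB_nodup 5 (by decide +kernel)

theorem LN_ne : LN ≠ [] := by decide +kernel
theorem LN_card : ∀ m ∈ LN, pc m = 5 := by decide +kernel
theorem LN_two : ∀ p ∈ leaves mm vs21 4 LN, p.2.length ≤ 2 := by decide +kernel
theorem LN_nb : ∀ x ∈ vs21, ∀ y ∈ vs21, ∃ m ∈ LN, mm m x = true ∧ mm m y = true := by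
  decide +kernel
theorem LN_f : ∀ k ∈ [(1, 21), (2, 210), (3, 490), (4, 525), (5, 210)],
    (leaves mm vs21 k.1 LN).length = k.2 := by decide +kernel

theorem link_B21 (x : VV) : linkFacets B21 x = cx (ord x) := by
  have hp := List.isPerm_iff.1 (ord_perm x (vs21_all x))
  have he : ∀ m ∈ LB, mm m x = true → dec (m - 2 ^ idx x) = (dec m).erase x := by
    intro m hm hx
    ext v
    rw [Finset.mem_erase, mem_dec, mem_dec, erase_chk x (vs21_all x) m hm hx v (vs21_all v)]
    simp [and_comm]
  ext σ
  rw [B21_eq, linkFacets, mem_cx]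
  simp only [← hp.mem_iff, Finset.mem_image, Finset.mem_filter, mem_cx, List.mem_map,
    List.mem_filter]
  constructor
  · rintro ⟨_, ⟨⟨m, hm, rfl⟩, hx⟩, rfl⟩
    rw [mem_dec] at hx
    exact ⟨_, ⟨m, ⟨hm, hx⟩, rfl⟩, he m hm hx⟩
  · rintro ⟨_, ⟨m, ⟨hm, hx⟩, rfl⟩, rfl⟩
    exact ⟨_, ⟨⟨m, hm, rfl⟩, mem_dec.2 hx⟩, (he m hm hx).symm⟩

theorem mem_vertexSet_of {V : Type*} [DecidableEq V] (F : Finset (Finset V)) (x : V)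
    (h : ∃ τ ∈ F, x ∈ τ ∧ x ∈ τ) : x ∈ vertexSet F := by
  obtain ⟨τ, h1, h2, _⟩ := h
  exact Finset.mem_biUnion.2 ⟨τ, h1, h2⟩

set_option linter.constructorNameAsVariable false

/-- The boundary complex is a 2-neighborly 4-dimensional weak
pseudomanifold on 21 vertices, every vertex link is a stacked 3-sphere (so it lies
in the Walkup class `K(4)`), its face vector is (21, 210, 490, 525, 210), and its
Euler characteristic is χ = (-14), so that `f₀ (f₀ - 11) = -15 χ`. -/
theorem stmt16 :
    (∀ τ ∈ N21, τ.card = 5) ∧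
      (∀ s : Finset (Fin 3 × ZMod 7), s.card = 4 → (N21.filter fun τ => s ⊆ τ).card ≤ 2) ∧
      (vertexSet N21).card = 21 ∧
      (∀ x ∈ vertexSet N21, ∀ y ∈ vertexSet N21, ∃ τ ∈ N21, x ∈ τ ∧ y ∈ τ) ∧
      (∀ x ∈ vertexSet N21, IsStackedSphere 3 (linkFacets N21 x)) ∧
      (faceCount N21 1 = 21 ∧ faceCount N21 2 = 210 ∧ faceCount N21 3 = 490 ∧
        faceCount N21 4 = 525 ∧ faceCount N21 5 = 210) ∧
      ((faceCount N21 1 : ℤ) - faceCount N21 2 + faceCount N21 3 - faceCount N21 4 +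
        faceCount N21 5 = (-14)) ∧
      ((faceCount N21 1 : ℤ) * ((faceCount N21 1 : ℤ) - 11) =
        -15 * ((faceCount N21 1 : ℤ) - faceCount N21 2 + faceCount N21 3 -
          faceCount N21 4 + faceCount N21 5)) := by
  have nb : ∀ x y : VV, ∃ τ ∈ N21, x ∈ τ ∧ y ∈ τ := by
    intro x y
    obtain ⟨m, hm, h1, h2⟩ := LN_nb x (vs21_all x) y (vs21_all y)
    rw [N21_eq]
    exact ⟨dec m, mem_cx.2 ⟨m, hm, rfl⟩, mem_dec.2 h1, mem_dec.2 h2⟩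
  have f1 : faceCount N21 1 = 21 := by
    rw [N21_eq, faceCount_cx _ LN_ne]; exact LN_f (1, 21) (by simp)
  have f2 : faceCount N21 2 = 210 := by
    rw [N21_eq, faceCount_cx _ LN_ne]; exact LN_f (2, 210) (by simp)
  have f3 : faceCount N21 3 = 490 := by
    rw [N21_eq, faceCount_cx _ LN_ne]; exact LN_f (3, 490) (by simp)
  have f4 : faceCount N21 4 = 525 := by
    rw [N21_eq, faceCount_cx _ LN_ne]; exact LN_f (4, 525) (by simp)
  have f5 : faceCount N21 5 = 210 := by
    rw [N21_eq, faceCount_cx _ LN_ne]; exact LN_f (5, 210) (by simp)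
  refine ⟨?_, ?_, ?_, fun x _ y _ => nb x y, ?_, ⟨f1, f2, f3, f4, f5⟩, ?_, ?_⟩
  · intro τ hτ
    rw [N21_eq, mem_cx] at hτ
    obtain ⟨m, hm, rfl⟩ := hτ
    rw [card_dec]
    exact LN_card m hm
  · intro s hs
    rw [N21_eq, filter_cx]
    refine (card_cx_le _).trans ?_
    by_cases h : ∃ m ∈ LN, s ⊆ dec m
    · exact LN_two _ (leaf_of h hs)
    · have : LN.filter (fun m => (lst s).all (mm m)) = [] := by
        rw [List.filter_eq_nil_iff]
        intro m hm hh
        exact h ⟨m, hm, all_iff.1 hh⟩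
      rw [this]; simp
  · have : vertexSet N21 = Finset.univ := by
      generalize N21 = F at nb
      exact Finset.eq_univ_iff_forall.2 fun x => mem_vertexSet_of F x (nb x x)
    rw [this, Finset.card_univ, Fintype.card_prod, ZMod.card, Fintype.card_fin]
  · intro x _
    refine ⟨cx (ord x), chk_sound 4 _ (ord_chk x (vs21_all x)), ?_⟩
    rw [N21, ← link_B21]
    exact link_bdry 4 B21 x
  · rw [f1, f2, f3, f4, f5]; norm_num
  · rw [f1, f2, f3, f4, f5]; norm_num
end

section
/- Let X be the pure 3-dimensional simplicial complex on the vertex set {1, 2, 3, 4, 5, 6, 7} with facets {1,2,3,4}, {2,3,4,5}, {3,4,5,6}, {4,5,6,7}, {5,6,7,1}. Then X is a pseudomanifold whose dual graph Λ(X) is a tree (in fact a path), but X is not a stacked 3-ball. -/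
variable {V : Type*} [DecidableEq V]

/-- The pure 3-dimensional complex on `{1, …, 7}` with facets
`1234, 2345, 3456, 4567, 5671`. -/
def X7 : Finset (Finset ℕ) :=
  { {1, 2, 3, 4}, {2, 3, 4, 5}, {3, 4, 5, 6}, {4, 5, 6, 7}, {5, 6, 7, 1} }

instance decAdjX7 : DecidableRel (dualGraph 3 X7).Adj := fun a b =>
  inferInstanceAs (Decidable (a ≠ b ∧ (a.1 ∩ b.1).card = 3))

/-- The complex `X` with facets `1234, 2345, 3456, 4567, 5671` is a
pure 3-dimensional pseudomanifold (a weak pseudomanifold with connected dual graph)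
whose dual graph `Λ(X)` is a tree (in fact a path), but `X` is not a stacked 3-ball. -/
theorem stmt19 :
    (∀ σ ∈ X7, σ.card = 4) ∧
      (∀ s : Finset ℕ, s.card = 3 → (X7.filter fun σ => s ⊆ σ).card ≤ 2) ∧
      (dualGraph 3 X7).Connected ∧
      (dualGraph 3 X7).IsTree ∧
      ¬ IsStackedBall 3 X7 := by
  have hconn : (dualGraph 3 X7).Connected := by
    have m1 : ({1, 2, 3, 4} : Finset ℕ) ∈ X7 := by decide
    have m2 : ({2, 3, 4, 5} : Finset ℕ) ∈ X7 := by decide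
    have m3 : ({3, 4, 5, 6} : Finset ℕ) ∈ X7 := by decide
    have m4 : ({4, 5, 6, 7} : Finset ℕ) ∈ X7 := by decide
    have m5 : ({5, 6, 7, 1} : Finset ℕ) ∈ X7 := by decide
    have a1 : (dualGraph 3 X7).Adj ⟨_, m1⟩ ⟨_, m2⟩ :=
      ⟨fun h => absurd (congrArg Subtype.val h) (by dsimp only; decide), by clear * -; decide +revert⟩
    have a2 : (dualGraph 3 X7).Adj ⟨_, m2⟩ ⟨_, m3⟩ :=
      ⟨fun h => absurd (congrArg Subtype.val h) (by dsimp only; decide), by clear * -; decide +revert⟩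
    have a3 : (dualGraph 3 X7).Adj ⟨_, m3⟩ ⟨_, m4⟩ :=
      ⟨fun h => absurd (congrArg Subtype.val h) (by dsimp only; decide), by clear * -; decide +revert⟩
    have a4 : (dualGraph 3 X7).Adj ⟨_, m4⟩ ⟨_, m5⟩ :=
      ⟨fun h => absurd (congrArg Subtype.val h) (by dsimp only; decide), by clear * -; decide +revert⟩
    have r2 := a1.reachable
    have r3 := r2.trans a2.reachable
    have r4 := r3.trans a3.reachable
    have r5 := r4.trans a4.reachable
    rw [SimpleGraph.connected_iff_exists_forall_reachable]
    refine ⟨⟨_, m1⟩, ?_⟩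
    rintro ⟨w, hw⟩
    have hw' := hw
    simp only [X7, Finset.mem_insert, Finset.mem_singleton] at hw'
    rcases hw' with rfl | rfl | rfl | rfl | rfl
    · exact SimpleGraph.Reachable.refl _
    · exact r2
    · exact r3
    · exact r4
    · exact r5
  refine ⟨by decide, ?_, hconn, ?_, ?_⟩
  · intro s hs
    by_cases h : ∃ σ ∈ X7, s ⊆ σ
    · obtain ⟨σ, hσ, hsσ⟩ := h
      have key : ∀ σ ∈ X7, ∀ s ∈ σ.powersetCard 3, (X7.filter fun σ => s ⊆ σ).card ≤ 2 := by
        decide +kernel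
      exact key σ hσ s (Finset.mem_powersetCard.2 ⟨hsσ, hs⟩)
    · push Not at h
      rw [Finset.filter_false_of_mem h]
      simp
  · rw [SimpleGraph.isTree_iff_connected_and_card]
    refine ⟨hconn, ?_⟩
    rw [Nat.card_eq_fintype_card, Nat.card_eq_fintype_card, ← SimpleGraph.edgeFinset_card]
    have h2 := (dualGraph 3 X7).sum_degrees_eq_twice_card_edges
    have h3 : ∑ v, (dualGraph 3 X7).degree v = 8 := by decide +kernel
    have h4 : Fintype.card {σ // σ ∈ X7} = 5 := by decide +kernel
    omega
  · intro h
    have key : ∀ σ ∈ X7, ((X7.erase σ).biUnion fun ρ => ρ ∩ σ).card = 4 := by decide +kernel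
    generalize hX : X7 = Y at h
    generalize hd : 3 = d at h
    cases h with
    | single σ h =>
      have := congrArg Finset.card hX
      rw [Finset.card_singleton] at this
      exact absurd this (by decide)
    | glue F σ τ _ _ hn _ hc _ hi =>
      have k := key σ (by rw [hX]; exact Finset.mem_insert_self _ _)
      rw [hX, Finset.erase_insert hn] at k
      have := Finset.card_le_card (Finset.biUnion_subset.2 hi)
      omega
end
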